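/- Few down-up edges at each vertex. Under assumptions (A1) and (A2), for every ν > 0, every constant c > 1 and every x ∈ [N], with ν-high probability #S_1^du(x) ≤ c · (ν/(1−2δ)) · log N / log log N. -/

import Mathlib

open MeasureTheory Real

namespace GRG

variable {N : ℕ}

/-! ### Generic graph-theoretic definitions over an adjacency relation on `Fin N` -/

/-- The degree of a vertex with respect to an adjacency relation. -/
noncomputable def degA (A : Fin N → Fin N → Prop) (x : Fin N) : ℕ :=
  {y | A x y}.ncard

/-- The strict total order `≺`: `x ≺ y` iff `D_x < D_y`, or `D_x = D_y` and `x > y`. -/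
def precA (A : Fin N → Fin N → Prop) (x y : Fin N) : Prop :=
  degA A x < degA A y ∨ (degA A x = degA A y ∧ y < x)

/-- `γ 0, γ 1, …, γ l` is a path for the adjacency relation `A`. -/
def IsPathOn (A : Fin N → Fin N → Prop) (l : ℕ) (γ : ℕ → Fin N) : Prop :=
  ∀ i < l, A (γ i) (γ (i + 1))

/-- A path of length `l` is simple: all vertices distinct except possibly endpoints. -/
def IsSimplePath (l : ℕ) (γ : ℕ → Fin N) : Prop :=
  ∀ i j, i < j → j ≤ l → ¬(i = 0 ∧ j = l) → γ i ≠ γ j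

/-- Two paths are edge-disjoint. -/
def EdgeDisjoint (l l' : ℕ) (γ γ' : ℕ → Fin N) : Prop :=
  ∀ i < l, ∀ j < l',
    ¬((γ i = γ' j ∧ γ (i + 1) = γ' (j + 1)) ∨ (γ i = γ' (j + 1) ∧ γ (i + 1) = γ' j))

/-- `S_1^cyc(x)`: neighbours of `x` that start a simple cycle through `x`
of length at most `2r+1`. -/
def S1cycA (A : Fin N → Fin N → Prop) (r : ℕ) (x : Fin N) : Set (Fin N) :=
  {y | A x y ∧ ∃ l γ, 3 ≤ l ∧ l ≤ 2 * r + 1 ∧ γ 0 = x ∧ γ 1 = y ∧ γ l = x ∧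
    IsPathOn A l γ ∧ IsSimplePath l γ}

/-- `S_1^du(x)`: neighbours `y ∉ S_1^cyc(x)` of `x` that have a neighbour
`z ∉ S_1^cyc(y)` with `y ≺ x ≺ z`. -/
def S1duA (A : Fin N → Fin N → Prop) (r : ℕ) (x : Fin N) : Set (Fin N) :=
  {y | A x y ∧ y ∉ S1cycA A r x ∧ precA A y x ∧
    ∃ z, A y z ∧ z ∉ S1cycA A r y ∧ precA A x z}

/-- Adjacency in the graph `G^nc` (after removing the cycle-creating edges). -/
def AdjNCA (A : Fin N → Fin N → Prop) (r : ℕ) (x y : Fin N) : Prop :=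
  A x y ∧ y ∉ S1cycA A r x ∧ x ∉ S1cycA A r y

/-- Adjacency in the pruned graph `G^p` (after further removing the down-up edges). -/
def AdjPA (A : Fin N → Fin N → Prop) (r : ℕ) (x y : Fin N) : Prop :=
  AdjNCA A r x y ∧ y ∉ S1duA A r x ∧ x ∉ S1duA A r y

/-- Degree in the pruned graph. -/
noncomputable def degPA (A : Fin N → Fin N → Prop) (r : ℕ) (x : Fin N) : ℕ :=
  {y | AdjPA A r x y}.ncard

/-- `S_1^{p−}(x)`: pruned-graph neighbours of `x` that are smaller than `x` for `≺`. -/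
def S1pmA (A : Fin N → Fin N → Prop) (r : ℕ) (x : Fin N) : Set (Fin N) :=
  {y | AdjPA A r x y ∧ precA A y x}

/-- `D_x^{p−}`. -/
noncomputable def degPmA (A : Fin N → Fin N → Prop) (r : ℕ) (x : Fin N) : ℕ :=
  (S1pmA A r x).ncard

/-- `Sib^−(x)`: the smaller siblings of `x` (children of the parent of `x`
that are smaller than `x`). -/
def SibmA (A : Fin N → Fin N → Prop) (r : ℕ) (x : Fin N) : Set (Fin N) :=
  {y | ∃ p, AdjPA A r x p ∧ precA A x p ∧ AdjPA A r p y ∧ precA A y p ∧ precA A y x}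

/-- The normalization constant `Z_x` (note `2/0 = 0` in Lean, so this agrees with the
convention `Z_x = 2` when `Sib^−(x) = ∅`). -/
noncomputable def ZxA (A : Fin N → Fin N → Prop) (r : ℕ) (x : Fin N) : ℝ :=
  2 + 2 / (SibmA A r x).ncard

/-- The indicator vector of a set of vertices. -/
noncomputable def indVec (S : Set (Fin N)) : Fin N → ℝ :=
  S.indicator 1

/-- The approximate eigenvector `u_σ(x)`. -/
noncomputable def uVecA (A : Fin N → Fin N → Prop) (r : ℕ) (σ : ℝ) (x : Fin N) :
    Fin N → ℝ := fun y =>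
  (Real.sqrt (ZxA A r x))⁻¹ *
    (indVec {x} y + σ * (Real.sqrt (degPmA A r x))⁻¹ * indVec (S1pmA A r x) y -
      indVec (SibmA A r x) y / (SibmA A r x).ncard)

/-- The star vector `v_σ(x)`. -/
noncomputable def vVecA (A : Fin N → Fin N → Prop) (r : ℕ) (σ : ℝ) (x : Fin N) :
    Fin N → ℝ := fun y =>
  (Real.sqrt 2)⁻¹ *
    (indVec {x} y + σ * (Real.sqrt (degPmA A r x))⁻¹ * indVec (S1pmA A r x) y)

/-- Euclidean scalar product on `ℝ^N`. -/
noncomputable def dotR (f g : Fin N → ℝ) : ℝ := ∑ y, f y * g y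

/-- The Euclidean (`ℓ² → ℓ²`) operator norm of an `N × N` real matrix. -/
noncomputable def opNorm (M : Matrix (Fin N) (Fin N) ℝ) : ℝ :=
  ‖Matrix.toEuclideanCLM (𝕜 := ℝ) M‖

open Classical in
/-- The adjacency matrix of the pruned graph. -/
noncomputable def adjMatrixPA (A : Fin N → Fin N → Prop) (r : ℕ) :
    Matrix (Fin N) (Fin N) ℝ := fun x y => if AdjPA A r x y then 1 else 0

/-- The threshold `ξ_ν`. -/
noncomputable def xi (ν δ : ℝ) (N : ℕ) : ℝ :=
  3 * (ν + 1) * (2 - 3 * δ) / ((1 - δ) * (1 - 2 * δ)) *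
    (Real.log N / Real.log (Real.log N))

/-- The set `V_ν^{(h)}` of high-degree vertices. -/
def VhA (A : Fin N → Fin N → Prop) (ν δ : ℝ) : Set (Fin N) :=
  {x | xi ν δ N ≤ (degA A x : ℝ)}

/-- The projection `Π^p` onto the span of the vectors `u_σ(x)`, `x ∈ V_ν^{(h)}`. -/
noncomputable def PiPA (A : Fin N → Fin N → Prop) (r : ℕ) (ν δ : ℝ) :
    Matrix (Fin N) (Fin N) ℝ :=
  ∑ x : Fin N, Set.indicator (VhA A ν δ) (fun _ => (1 : ℝ)) x •
    (Matrix.vecMulVec (uVecA A r 1 x) (uVecA A r 1 x) +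
      Matrix.vecMulVec (uVecA A r (-1) x) (uVecA A r (-1) x))

/-- The block-diagonal approximation `Â`. -/
noncomputable def AhatA (A : Fin N → Fin N → Prop) (r : ℕ) (ν δ : ℝ) :
    Matrix (Fin N) (Fin N) ℝ :=
  (∑ x : Fin N, Set.indicator (VhA A ν δ) (fun _ => (1 : ℝ)) x •
    (Real.sqrt (degPmA A r x) •
      (Matrix.vecMulVec (uVecA A r 1 x) (uVecA A r 1 x) -
        Matrix.vecMulVec (uVecA A r (-1) x) (uVecA A r (-1) x)))) +
  (1 - PiPA A r ν δ) * adjMatrixPA A r * (1 - PiPA A r ν δ)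

/-! ### The generalized random graph (GRG) model -/

/-- Index set of potential edges. -/
abbrev EdgeIdx (N : ℕ) := {p : Fin N × Fin N // p.1 < p.2}

/-- The edge probabilities `p_{xy} = w_x w_y / (Σ_z w_z + w_x w_y)`. -/
noncomputable def pGRG (w : Fin N → ℝ) (x y : Fin N) : ℝ :=
  w x * w y / ((∑ z, w z) + w x * w y)

/-- Bernoulli measure with parameter `p` on `Bool`. -/
noncomputable def bern (p : ℝ) : Measure Bool :=
  ENNReal.ofReal p • Measure.dirac true + ENNReal.ofReal (1 - p) • Measure.dirac false

instance (p : ℝ) : IsFiniteMeasure (bern p) := by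
  constructor
  simp only [bern, Measure.coe_add, Measure.coe_smul, Pi.add_apply, Pi.smul_apply,
    smul_eq_mul, measure_univ, mul_one]
  exact ENNReal.add_lt_top.mpr ⟨ENNReal.ofReal_lt_top, ENNReal.ofReal_lt_top⟩

/-- The law of the GRG: independent Bernoulli edge indicators. -/
noncomputable def grgMeasure (w : Fin N → ℝ) : Measure (EdgeIdx N → Bool) :=
  Measure.pi fun e => bern (pGRG w e.val.1 e.val.2)

/-- The (random) adjacency matrix. -/
noncomputable def adjMatrix (ω : EdgeIdx N → Bool) : Matrix (Fin N) (Fin N) ℝ :=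
  fun x y =>
    if h : x < y then (if ω ⟨(x, y), h⟩ then 1 else 0)
    else if h' : y < x then (if ω ⟨(y, x), h'⟩ then 1 else 0)
    else 0

/-- The (random) adjacency relation. -/
def Adj (ω : EdgeIdx N → Bool) (x y : Fin N) : Prop := adjMatrix ω x y = 1

/-- The (random) degree `D_x`. -/
noncomputable def deg (ω : EdgeIdx N → Bool) (x : Fin N) : ℕ := degA (Adj ω) x

/-- The first empirical moment `m_1`. -/
noncomputable def m1 (w : Fin N → ℝ) : ℝ := (∑ x, w x) / N

/-- The second empirical moment `m_2`. -/
noncomputable def m2 (w : Fin N → ℝ) : ℝ := (∑ x, w x ^ 2) / N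

/-- The expected degree `d_x = E[D_x]`. -/
noncomputable def dExp (w : Fin N → ℝ) (x : Fin N) : ℝ :=
  ∫ ω, (deg ω x : ℝ) ∂(grgMeasure w)

/-- The set `W_{λ,η}` of resonant vertices. -/
def resonant (ω : EdgeIdx N → Bool) (lam η : ℝ) : Set (Fin N) :=
  {x | |Real.sqrt (deg ω x) - lam| ≤ η}

/-- The set `V*_{ν,η}` of isolated vertices. -/
noncomputable def Vstar (w : Fin N → ℝ) (ν η : ℝ) : Set (Fin N) :=
  {x | (4 * ν / 9) * Real.log N ≤ dExp w x ∧
    ∀ y, y ≠ x →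
      max (4 * Real.sqrt (ν * Real.log N * dExp w x) +
            4 * Real.sqrt (ν * Real.log N * dExp w y))
          (16 * η ^ 2) ≤ |dExp w x - dExp w y|}

end GRG

namespace GRG

/-! ### Helper lemmas -/

/-- The edge index of an unordered pair of distinct vertices. -/
def mkE {N : ℕ} (a b : Fin N) (h : a ≠ b) : EdgeIdx N :=
  ⟨(min a b, max a b), min_lt_max.2 h⟩

lemma mkE_inj {N : ℕ} {a b c d : Fin N} {h : a ≠ b} {h' : c ≠ d} (he : mkE a b h = mkE c d h') :
    (a = c ∧ b = d) ∨ (a = d ∧ b = c) := by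
  simp only [mkE, Subtype.mk.injEq, Prod.mk.injEq] at he
  obtain ⟨h1, h2⟩ := he
  rcases le_total a b with hab | hab <;> rcases le_total c d with hcd | hcd <;>
    simp_all

lemma adj_ne {N : ℕ} {ω : EdgeIdx N → Bool} {a b : Fin N} (h : Adj ω a b) : a ≠ b := by
  rintro rfl
  simp [Adj, adjMatrix] at h

lemma adj_iff {N : ℕ} (ω : EdgeIdx N → Bool) {a b : Fin N} (h : a ≠ b) :
    Adj ω a b ↔ ω (mkE a b h) = true := by
  rcases lt_or_gt_of_ne h with hab | hab
  · simp [Adj, adjMatrix, mkE, hab, hab.le]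
  · simp [Adj, adjMatrix, mkE, hab, hab.le, hab.not_gt]

lemma adj_symm {N : ℕ} {ω : EdgeIdx N → Bool} {a b : Fin N} (h : Adj ω a b) : Adj ω b a := by
  have hne := adj_ne h
  rw [adj_iff ω hne] at h
  rw [adj_iff ω hne.symm]
  rw [← h]
  congr 1
  simp [mkE, min_comm, max_comm]

lemma pGRG_symm {N : ℕ} (w : Fin N → ℝ) (a b : Fin N) : pGRG w a b = pGRG w b a := by
  simp [pGRG, mul_comm]

lemma pGRG_mkE {N : ℕ} (w : Fin N → ℝ) {a b : Fin N} (h : a ≠ b) :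
    pGRG w (mkE a b h).1.1 (mkE a b h).1.2 = pGRG w a b := by
  rcases le_total a b with hab | hab
  · simp [mkE, hab]
  · simp [mkE, hab, pGRG_symm w b a]

lemma sum_w_pos {N : ℕ} {w : Fin N → ℝ} (hw : ∀ x, 0 < w x) (x : Fin N) : 0 < ∑ z, w z :=
  Finset.sum_pos (fun i _ => hw i) ⟨x, Finset.mem_univ x⟩

lemma pGRG_nonneg {N : ℕ} {w : Fin N → ℝ} (hw : ∀ x, 0 < w x) (a b : Fin N) :
    0 ≤ pGRG w a b := by
  have := sum_w_pos hw a
  have := hw a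
  have := hw b
  unfold pGRG
  positivity

lemma pGRG_le_one {N : ℕ} {w : Fin N → ℝ} (hw : ∀ x, 0 < w x) (a b : Fin N) :
    pGRG w a b ≤ 1 := by
  have := sum_w_pos hw a
  have := hw a
  have := hw b
  unfold pGRG
  rw [div_le_one (by positivity)]
  linarith

lemma pGRG_le {N : ℕ} {w : Fin N → ℝ} (hw : ∀ x, 0 < w x) (a b : Fin N) :
    pGRG w a b ≤ w a * w b / ∑ z, w z := by
  have := sum_w_pos hw a
  have := hw a
  have := hw b
  unfold pGRG
  gcongr
  nlinarith

lemma bern_prob {p : ℝ} (h0 : 0 ≤ p) (h1 : p ≤ 1) : IsProbabilityMeasure (bern p) := by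
  constructor
  simp only [bern, Measure.coe_add, Measure.coe_smul, Pi.add_apply, Pi.smul_apply,
    smul_eq_mul, measure_univ, mul_one]
  rw [← ENNReal.ofReal_add h0 (by linarith)]
  simp

lemma bern_true (p : ℝ) : bern p {true} = ENNReal.ofReal p := by
  simp [bern]

lemma grg_prob {N : ℕ} {w : Fin N → ℝ} (hw : ∀ x, 0 < w x) :
    IsProbabilityMeasure (grgMeasure w) := by
  have : ∀ e : EdgeIdx N, IsProbabilityMeasure (bern (pGRG w e.val.1 e.val.2)) := fun e =>
    bern_prob (pGRG_nonneg hw _ _) (pGRG_le_one hw _ _)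
  unfold grgMeasure
  infer_instance

lemma prob_edges {N : ℕ} {w : Fin N → ℝ} (hw : ∀ x, 0 < w x) {ι : Type} [Fintype ι]
    (e : ι → EdgeIdx N) (he : Function.Injective e) :
    grgMeasure w {ω | ∀ i, ω (e i) = true} =
      ∏ i, ENNReal.ofReal (pGRG w (e i).1.1 (e i).1.2) := by
  classical
  have : ∀ e : EdgeIdx N, IsProbabilityMeasure (bern (pGRG w e.val.1 e.val.2)) := fun e =>
    bern_prob (pGRG_nonneg hw _ _) (pGRG_le_one hw _ _)
  have hset : {ω : EdgeIdx N → Bool | ∀ i, ω (e i) = true} =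
      Set.pi Set.univ (fun j => if j ∈ Finset.univ.image e then {true} else Set.univ) := by
    ext ω
    simp only [Set.mem_ofPred_eq, Set.mem_pi, Set.mem_univ, true_implies]
    constructor
    · intro h j
      split_ifs with hj
      · simp only [Finset.mem_image, Finset.mem_univ, true_and] at hj
        obtain ⟨i, rfl⟩ := hj
        exact h i
      · trivial
    · intro h i
      have := h (e i)
      simpa using this
  rw [hset, grgMeasure, Measure.pi_pi]
  have : ∀ j : EdgeIdx N, bern (pGRG w j.val.1 j.val.2)
      (if j ∈ Finset.univ.image e then {true} else Set.univ) =
      if j ∈ Finset.univ.image e then ENNReal.ofReal (pGRG w j.val.1 j.val.2) else 1 := by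
    intro j
    split_ifs
    · exact bern_true _
    · exact measure_univ
  simp_rw [this]
  rw [Finset.prod_ite_mem, Finset.univ_inter, Finset.prod_image (fun a _ b _ h => he h)]

/-! ### Cycles -/

lemma cyc3 {N : ℕ} {A : Fin N → Fin N → Prop} {r : ℕ} (hr : 6 ≤ r) {x a b : Fin N}
    (h1 : A x a) (h2 : A a b) (h3 : A b x) (hxa : x ≠ a) (hxb : x ≠ b) (hab : a ≠ b) :
    a ∈ S1cycA A r x := by
  refine ⟨h1, 3, fun i => if i = 1 then a else if i = 2 then b else x, le_rfl, by omega,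
    by simp, by simp, by simp, ?_, ?_⟩
  · intro i hi
    interval_cases i <;> simp [*]
  · intro i j hij hj h
    interval_cases j <;> interval_cases i <;> simp_all [Ne.symm]

lemma cyc4 {N : ℕ} {A : Fin N → Fin N → Prop} {r : ℕ} (hr : 6 ≤ r) {x a b c : Fin N}
    (h1 : A x a) (h2 : A a b) (h3 : A b c) (h4 : A c x) (hxa : x ≠ a) (hxb : x ≠ b)
    (hxc : x ≠ c) (hab : a ≠ b) (hac : a ≠ c) (hbc : b ≠ c) :
    a ∈ S1cycA A r x := by
  refine ⟨h1, 4, fun i => if i = 1 then a else if i = 2 then b else if i = 3 then c else x,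
    by omega, by omega, by simp, by simp, by simp, ?_, ?_⟩
  · intro i hi
    interval_cases i <;> simp [*]
  · have hbx := hxb.symm
    have hcx := hxc.symm
    have hax := hxa.symm
    intro i j hij hj h
    interval_cases j <;> interval_cases i <;> simp_all

lemma cyc5 {N : ℕ} {A : Fin N → Fin N → Prop} {r : ℕ} (hr : 6 ≤ r) {x a b c d : Fin N}
    (h1 : A x a) (h2 : A a b) (h3 : A b c) (h4 : A c d) (h5 : A d x)
    (hxa : x ≠ a) (hxb : x ≠ b) (hxc : x ≠ c) (hxd : x ≠ d) (hab : a ≠ b) (hac : a ≠ c)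
    (had : a ≠ d) (hbc : b ≠ c) (hbd : b ≠ d) (hcd : c ≠ d) :
    a ∈ S1cycA A r x := by
  refine ⟨h1, 5, fun i => if i = 1 then a else if i = 2 then b else if i = 3 then c else
    if i = 4 then d else x,
    by omega, by omega, by simp, by simp, by simp, ?_, ?_⟩
  · intro i hi
    interval_cases i <;> simp [*]
  · have hbx := hxb.symm
    have hcx := hxc.symm
    have hdx := hxd.symm
    have hax := hxa.symm
    intro i j hij hj h
    interval_cases j <;> interval_cases i <;> simp_all

/-! ### The tree events -/

/-- The combinatorial genericity of the tree with root `x`, children `S`, and paths below. -/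
structure Good {N : ℕ} (x : Fin N) (S : Finset (Fin N)) (g : S → Fin N × Fin N) : Prop where
  hx : x ∉ S
  zx : ∀ y, (g y).1 ≠ x
  zS : ∀ y, (g y).1 ∉ S
  zinj : Function.Injective (fun y => (g y).1)
  ux : ∀ y, (g y).2 ≠ x
  uS : ∀ y, (g y).2 ∉ S
  uz : ∀ y y', (g y).2 ≠ (g y').1

/-- All the edges of the tree are present. -/
def Ev {N : ℕ} (x : Fin N) (S : Finset (Fin N)) (g : S → Fin N × Fin N) :
    Set (EdgeIdx N → Bool) :=
  {ω | ∀ y : S, Adj ω x y ∧ Adj ω y (g y).1 ∧ Adj ω (g y).1 (g y).2}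

lemma prob_Ev {N : ℕ} {w : Fin N → ℝ} (hw : ∀ x, 0 < w x) {x : Fin N} {S : Finset (Fin N)}
    {g : S → Fin N × Fin N} (hg : Good x S g) :
    grgMeasure w (Ev x S g) = ENNReal.ofReal (∏ y : S,
      (pGRG w x y * pGRG w y (g y).1 * pGRG w (g y).1 (g y).2)) := by
  have h1 : ∀ y : S, x ≠ y := fun y h => hg.hx (h ▸ y.2)
  have h2 : ∀ y : S, (y : Fin N) ≠ (g y).1 := fun y h => hg.zS y (h ▸ y.2)
  have h3 : ∀ y : S, (g y).1 ≠ (g y).2 := fun y h => hg.uz y y h.symm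
  let e : S ⊕ (S ⊕ S) → EdgeIdx N := Sum.elim (fun y => mkE x y (h1 y))
    (Sum.elim (fun y => mkE y (g y).1 (h2 y)) (fun y => mkE (g y).1 (g y).2 (h3 y)))
  have he : Function.Injective e := by
    rintro (y | y | y) (y' | y' | y') h <;> simp only [e, Sum.elim_inl, Sum.elim_inr] at h <;>
      have h' := mkE_inj h
    · rcases h' with h' | h'
      · rw [Subtype.ext h'.2]
      · exact absurd h'.1 (h1 y')
    · rcases h' with h' | h'
      · exact absurd h'.1 (h1 y')
      · exact absurd h'.1.symm (hg.zx y')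
    · rcases h' with h' | h'
      · exact absurd h'.1.symm (hg.zx y')
      · exact absurd h'.1.symm (hg.ux y')
    · rcases h' with h' | h'
      · exact absurd h'.1.symm (h1 y)
      · exact absurd h'.2 (hg.zx y)
    · rcases h' with h' | h'
      · rw [Subtype.ext h'.1]
      · exact absurd (h'.1 ▸ y.2) (hg.zS y')
    · rcases h' with h' | h'
      · exact absurd (h'.1 ▸ y.2) (hg.zS y')
      · exact absurd (h'.1 ▸ y.2) (hg.uS y')
    · rcases h' with h' | h'
      · exact absurd h'.1 (hg.zx y)
      · exact absurd h'.2 (hg.ux y)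
    · rcases h' with h' | h'
      · exact absurd (h'.1 ▸ y'.2) (hg.zS y)
      · exact absurd (h'.2 ▸ y'.2) (hg.uS y)
    · rcases h' with h' | h'
      · rw [hg.zinj h'.1]
      · exact absurd h'.2 (hg.uz y y')
  have hset : Ev x S g = {ω | ∀ i, ω (e i) = true} := by
    ext ω
    simp only [Ev, Set.mem_ofPred_eq, Sum.forall, e, Sum.elim_inl, Sum.elim_inr,
      ← forall_and]
    refine forall_congr' fun y => ?_
    rw [adj_iff ω (h1 y), adj_iff ω (h2 y), adj_iff ω (h3 y)]
  rw [hset, prob_edges hw e he, ← ENNReal.ofReal_prod_of_nonneg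
    (fun i _ => pGRG_nonneg hw _ _)]
  congr 1
  rw [Fintype.prod_sum_type, Fintype.prod_sum_type]
  simp only [e, Sum.elim_inl, Sum.elim_inr, pGRG_mkE]
  rw [Finset.prod_mul_distrib, Finset.prod_mul_distrib, mul_assoc]

open Classical in
lemma event_count {N : ℕ} {r : ℕ} (hr : 6 ≤ r) (ω : EdgeIdx N → Bool) (x : Fin N) (n K : ℕ)
    (hn : n ≤ (S1duA (Adj ω) r x).ncard) (hK : K + 1 ≤ degA (Adj ω) x) :
    ∃ S ∈ Finset.powersetCard n (Finset.univ : Finset (Fin N)),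
      K ^ n ≤ (Finset.univ.filter fun g : S → Fin N × Fin N => Good x S g ∧ ω ∈ Ev x S g).card := by
  rw [Set.ncard_eq_toFinset_card'] at hn
  obtain ⟨S, hS, hSn⟩ := Finset.exists_subset_card_eq hn
  refine ⟨S, Finset.mem_powersetCard.2 ⟨Finset.subset_univ _, hSn⟩, ?_⟩
  have hdu : ∀ y : S, (y : Fin N) ∈ S1duA (Adj ω) r x := fun y => by
    have := hS y.2
    simpa using this
  have hxy : ∀ y : S, Adj ω x y := fun y => (hdu y).1
  have hnc : ∀ y : S, (y : Fin N) ∉ S1cycA (Adj ω) r x := fun y => (hdu y).2.1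
  choose z hyz _ hxz using fun y : S => (hdu y).2.2.2
  have zx : ∀ y, z y ≠ x := by
    intro y h
    have := hxz y
    rw [h] at this
    simp [precA] at this
  have hdeg : ∀ y, K + 1 ≤ degA (Adj ω) (z y) := by
    intro y
    rcases hxz y with h | h <;> omega
  have xS : x ∉ S := fun h => adj_ne (hxy ⟨x, h⟩) rfl
  have zS : ∀ y, z y ∉ S := by
    intro y h
    exact hnc y (cyc3 hr (hxy y) (hyz y) (adj_symm (hxy ⟨z y, h⟩)) (adj_ne (hxy y))
      (zx y).symm (adj_ne (hyz y)))
  have zinj : Function.Injective z := by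
    intro y y' h
    by_contra hne
    exact hnc y (cyc4 hr (hxy y) (hyz y) (h ▸ adj_symm (hyz y')) (adj_symm (hxy y'))
      (adj_ne (hxy y)) (zx y).symm (adj_ne (hxy y')) (adj_ne (hyz y))
      (fun h => hne (Subtype.ext h)) (fun h' => zS y (h' ▸ y'.2)))
  have ux : ∀ y, ∀ u, Adj ω (z y) u → u ≠ x := by
    rintro y u hu rfl
    exact hnc y (cyc3 hr (hxy y) (hyz y) hu (adj_ne (hxy y)) (zx y).symm (adj_ne (hyz y)))
  have uS : ∀ y : S, ∀ u, Adj ω (z y) u → u ≠ y → u ∉ S := by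
    intro y u hu huy huS
    exact hnc y (cyc4 hr (hxy y) (hyz y) hu (adj_symm (hxy ⟨u, huS⟩)) (adj_ne (hxy y))
      (zx y).symm (ux y u hu).symm (adj_ne (hyz y)) huy.symm (adj_ne hu))
  have uz : ∀ y : S, ∀ u, Adj ω (z y) u → ∀ y' : S, u ≠ z y' := by
    rintro y u hu y' rfl
    have hyy : y ≠ y' := by
      rintro rfl
      exact adj_ne hu rfl
    exact hnc y (cyc5 hr (hxy y) (hyz y) hu (adj_symm (hyz y')) (adj_symm (hxy y'))
      (adj_ne (hxy y)) (zx y).symm (zx y').symm (adj_ne (hxy y')) (adj_ne (hyz y))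
      (fun h => zS y' (h ▸ y.2)) (fun h => hyy (Subtype.ext h)) (adj_ne hu)
      (fun h => zS y (h ▸ y'.2)) (adj_ne (hyz y')).symm)
  let U : S → Finset (Fin N) := fun y => (Finset.univ.filter fun u => Adj ω (z y) u).erase y
  have hU : ∀ y, K ≤ (U y).card := by
    intro y
    have h1 := hdeg y
    have h2 : degA (Adj ω) (z y) = (Finset.univ.filter fun u => Adj ω (z y) u).card := by
      rw [degA, Set.ncard_eq_toFinset_card']
      congr 1
      ext u
      simp
    have h3 := Finset.pred_card_le_card_erase (s := Finset.univ.filter fun u => Adj ω (z y) u)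
      (a := (y : Fin N))
    simp only [U]
    omega
  calc K ^ n = ∏ y : S, K := by simp [hSn]
    _ ≤ ∏ y : S, (({z y} : Finset (Fin N)) ×ˢ U y).card := by
        refine Finset.prod_le_prod' fun y _ => ?_
        simpa using hU y
    _ = (Fintype.piFinset fun y : S => ({z y} : Finset (Fin N)) ×ˢ U y).card := by
        rw [Fintype.card_piFinset]
    _ ≤ _ := by
        refine Finset.card_le_card ?_
        intro g hg
        rw [Fintype.mem_piFinset] at hg
        have hg1 : ∀ y, (g y).1 = z y := fun y => by
          have := hg y
          simp only [Finset.mem_product, Finset.mem_singleton] at this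
          exact this.1
        have hg2 : ∀ y : S, (g y).2 ≠ y ∧ Adj ω (z y) (g y).2 := fun y => by
          have := hg y
          simp only [Finset.mem_product, Finset.mem_singleton, U, Finset.mem_erase,
            Finset.mem_filter, Finset.mem_univ, true_and] at this
          exact this.2
        simp only [Finset.mem_filter, Finset.mem_univ, true_and]
        refine ⟨⟨xS, fun y => hg1 y ▸ zx y, fun y => hg1 y ▸ zS y, ?_,
          fun y => ux y _ (hg2 y).2, fun y => uS y _ (hg2 y).2 (hg2 y).1,
          fun y y' => hg1 y' ▸ uz y _ (hg2 y).2 y'⟩, fun y => ⟨hxy y, ?_, ?_⟩⟩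
        · intro y y' h
          simp only [hg1] at h
          exact zinj h
        · rw [hg1]; exact hyz y
        · rw [hg1]; exact (hg2 y).2

end GRG

namespace GRG

open Classical in
lemma count_markov {Ω : Type} [MeasurableSpace Ω] [DiscreteMeasurableSpace Ω] (μ : Measure Ω)
    {T : Type} [Fintype T] (ev : T → Set Ω) (P : T → Prop) (b : T → ENNReal) (E : Set Ω) (k : ℕ)
    (h : ∀ ω ∈ E, k ≤ (Finset.univ.filter fun t => P t ∧ ω ∈ ev t).card)
    (hb : ∀ t, P t → μ (ev t) ≤ b t) : (k : ENNReal) * μ E ≤ ∑ t, b t := by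
  calc (k : ENNReal) * μ E = ∫⁻ ω, E.indicator (fun _ => (k : ENNReal)) ω ∂μ := by
        rw [lintegral_indicator_const (MeasurableSet.of_discrete)]
    _ ≤ ∫⁻ ω, ∑ t ∈ Finset.univ.filter P, (ev t).indicator (fun _ => (1 : ENNReal)) ω ∂μ := by
        refine lintegral_mono fun ω => ?_
        by_cases hω : ω ∈ E
        · rw [Set.indicator_of_mem hω]
          simp only [Set.indicator_apply]
          rw [← Finset.sum_filter, Finset.filter_filter]
          simpa using h ω hω
        · rw [Set.indicator_of_notMem hω]
          exact zero_le
    _ = ∑ t ∈ Finset.univ.filter P, μ (ev t) := by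
        rw [lintegral_finsetSum _ (fun t _ => Measurable.of_discrete)]
        refine Finset.sum_congr rfl fun t _ => ?_
        rw [lintegral_indicator_const (MeasurableSet.of_discrete), one_mul]
    _ ≤ ∑ t ∈ Finset.univ.filter P, b t := Finset.sum_le_sum fun t ht => hb t (by simpa using ht)
    _ ≤ ∑ t, b t := Finset.sum_le_sum_of_subset (Finset.filter_subset _ _)

lemma esymm_bound {V : Type} [Fintype V] (b : V → ℝ) (hb : ∀ y, 0 ≤ b y) (B : ℝ) (hB : 0 < B)
    (hbB : ∑ y, b y ≤ B) (n : ℕ) (hn : 1 ≤ n) :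
    ∑ S ∈ Finset.powersetCard n (Finset.univ : Finset V), ∏ y ∈ S, b y ≤
      (Real.exp 1 * B / n) ^ n := by
  have hn0 : (0 : ℝ) < n := by exact_mod_cast hn
  set t : ℝ := n / B with ht
  have ht0 : 0 < t := by positivity
  have h1 : t ^ n * ∑ S ∈ Finset.powersetCard n (Finset.univ : Finset V), ∏ y ∈ S, b y ≤
      Real.exp n := by
    calc t ^ n * ∑ S ∈ Finset.powersetCard n (Finset.univ : Finset V), ∏ y ∈ S, b y
        = ∑ S ∈ Finset.powersetCard n (Finset.univ : Finset V), ∏ y ∈ S, (t * b y) := by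
          rw [Finset.mul_sum]
          refine Finset.sum_congr rfl fun S hS => ?_
          rw [Finset.prod_mul_distrib, Finset.prod_const, (Finset.mem_powersetCard.1 hS).2]
      _ ≤ ∑ S ∈ (Finset.univ : Finset V).powerset, ∏ y ∈ S, (t * b y) := by
          refine Finset.sum_le_sum_of_subset_of_nonneg ?_ ?_
          · intro S hS
            simp
          · intro S _ _
            exact Finset.prod_nonneg fun y _ => mul_nonneg ht0.le (hb y)
      _ = ∏ y, (1 + t * b y) := (Finset.prod_one_add _).symm
      _ ≤ ∏ y, Real.exp (t * b y) := by
          refine Finset.prod_le_prod (fun y _ => ?_) fun y _ => ?_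
          · have := mul_nonneg ht0.le (hb y)
            linarith
          · have := Real.add_one_le_exp (t * b y)
            linarith
      _ = Real.exp (t * ∑ y, b y) := by rw [← Real.exp_sum, Finset.mul_sum]
      _ ≤ Real.exp n := by
          refine Real.exp_le_exp.2 ?_
          calc t * ∑ y, b y ≤ t * B := by gcongr
            _ = n := by rw [ht]; field_simp
  have h2 : (Real.exp 1 * B / n) ^ n = Real.exp n / t ^ n := by
    rw [ht, div_pow, mul_pow, div_pow, ← Real.exp_nat_mul, mul_one]
    field_simp
  rw [h2, le_div_iff₀ (by positivity), mul_comm]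
  exact h1

lemma sum_pGRG_le {N : ℕ} {w : Fin N → ℝ} (hw : ∀ x, 0 < w x) (z : Fin N) :
    ∑ u, pGRG w z u ≤ w z := by
  have hW := sum_w_pos hw z
  calc ∑ u, pGRG w z u ≤ ∑ u, w z * w u / ∑ z, w z :=
        Finset.sum_le_sum fun u _ => pGRG_le hw z u
    _ = w z := by
        rw [← Finset.sum_div, ← Finset.mul_sum]
        field_simp

lemma sum_tree_le {N : ℕ} {w : Fin N → ℝ} (hw : ∀ x, 0 < w x) (x : Fin N) :
    ∑ y, ∑ q : Fin N × Fin N, pGRG w x y * pGRG w y q.1 * pGRG w q.1 q.2 ≤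
      w x * ((∑ z, w z ^ 2) / ∑ z, w z) ^ 2 := by
  have hW := sum_w_pos hw x
  set W := ∑ z, w z with hWdef
  calc ∑ y, ∑ q : Fin N × Fin N, pGRG w x y * pGRG w y q.1 * pGRG w q.1 q.2
      = ∑ y, ∑ z, pGRG w x y * pGRG w y z * ∑ u, pGRG w z u := by
        refine Finset.sum_congr rfl fun y _ => ?_
        rw [Fintype.sum_prod_type]
        refine Finset.sum_congr rfl fun z _ => ?_
        rw [Finset.mul_sum]
    _ ≤ ∑ y, ∑ z, (w x * w y / W) * (w y * w z / W) * w z := by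
        refine Finset.sum_le_sum fun y _ => Finset.sum_le_sum fun z _ => ?_
        have h1 := pGRG_le hw x y
        have h2 := pGRG_le hw y z
        have h3 := sum_pGRG_le hw z
        have := pGRG_nonneg hw x y
        have := pGRG_nonneg hw y z
        have := hw x
        have := hw y
        have := hw z
        have : 0 ≤ ∑ u, pGRG w z u := Finset.sum_nonneg fun u _ => pGRG_nonneg hw z u
        gcongr
    _ = ∑ y, ∑ z, (w x / W ^ 2) * (w y ^ 2 * w z ^ 2) := by
        refine Finset.sum_congr rfl fun y _ => Finset.sum_congr rfl fun z _ => ?_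
        field_simp
    _ = w x * ((∑ z, w z ^ 2) / W) ^ 2 := by
        simp_rw [← Finset.mul_sum]
        rw [← Finset.sum_mul]
        field_simp

lemma tree_bound {N : ℕ} {w : Fin N → ℝ} (hw : ∀ x, 0 < w x) {r : ℕ} (hr : 6 ≤ r) (x : Fin N)
    (n K : ℕ) (hn : 1 ≤ n) (hK : 1 ≤ K) :
    grgMeasure w {ω | n ≤ (S1duA (Adj ω) r x).ncard ∧ K + 1 ≤ degA (Adj ω) x} ≤
      ENNReal.ofReal ((Real.exp 1 * (w x * ((∑ z, w z ^ 2) / ∑ z, w z) ^ 2) / (n * K)) ^ n) := by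
  classical
  have hW := sum_w_pos hw x
  have hW2 : 0 < ∑ z, w z ^ 2 := Finset.sum_pos (fun i _ => pow_pos (hw i) 2) ⟨x, Finset.mem_univ x⟩
  have hwx := hw x
  set B := w x * ((∑ z, w z ^ 2) / ∑ z, w z) ^ 2 with hB
  have hB0 : 0 < B := by positivity
  have hn0 : (0 : ℝ) < n := by exact_mod_cast hn
  have hK0 : (0 : ℝ) < K := by exact_mod_cast hK
  set f : Fin N → Fin N × Fin N → ℝ := fun y q => pGRG w x y * pGRG w y q.1 * pGRG w q.1 q.2
    with hf
  have hf0 : ∀ y q, 0 ≤ f y q := fun y q =>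
    mul_nonneg (mul_nonneg (pGRG_nonneg hw _ _) (pGRG_nonneg hw _ _)) (pGRG_nonneg hw _ _)
  let ES : Finset (Fin N) → Set (EdgeIdx N → Bool) := fun S =>
    {ω | K ^ n ≤ (Finset.univ.filter fun g : S → Fin N × Fin N => Good x S g ∧ ω ∈ Ev x S g).card}
  set E := {ω : EdgeIdx N → Bool | n ≤ (S1duA (Adj ω) r x).ncard ∧ K + 1 ≤ degA (Adj ω) x}
  have hES : ∀ S : Finset (Fin N), ((K ^ n : ℕ) : ENNReal) * grgMeasure w (ES S) ≤
      ENNReal.ofReal (∏ y ∈ S, ∑ q, f y q) := by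
    intro S
    have h := count_markov (grgMeasure w) (Ev x S) (Good x S)
      (fun g => ENNReal.ofReal (∏ y : S, f y (g y))) (ES S) (K ^ n) (fun ω hω => hω)
      (fun g hg => (prob_Ev hw hg).le)
    refine h.trans (le_of_eq ?_)
    rw [← ENNReal.ofReal_sum_of_nonneg (fun g _ => Finset.prod_nonneg fun y _ => hf0 _ _)]
    congr 1
    rw [← Finset.prod_coe_sort, Finset.prod_univ_sum]
    simp
  have hsub : E ⊆ ⋃ S ∈ Finset.powersetCard n (Finset.univ : Finset (Fin N)), ES S := by
    intro ω hω
    obtain ⟨S, hS, h⟩ := event_count hr ω x n K hω.1 hω.2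
    simp only [Set.mem_iUnion]
    exact ⟨S, hS, h⟩
  have hmain : ((K ^ n : ℕ) : ENNReal) * grgMeasure w E ≤
      ENNReal.ofReal ((Real.exp 1 * B / n) ^ n) := by
    calc ((K ^ n : ℕ) : ENNReal) * grgMeasure w E
        ≤ ((K ^ n : ℕ) : ENNReal) *
          ∑ S ∈ Finset.powersetCard n (Finset.univ : Finset (Fin N)), grgMeasure w (ES S) := by
          gcongr
          exact (measure_mono hsub).trans (measure_biUnion_finset_le _ _)
      _ ≤ ∑ S ∈ Finset.powersetCard n (Finset.univ : Finset (Fin N)),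
            ENNReal.ofReal (∏ y ∈ S, ∑ q, f y q) := by
          rw [Finset.mul_sum]
          exact Finset.sum_le_sum fun S _ => hES S
      _ = ENNReal.ofReal (∑ S ∈ Finset.powersetCard n (Finset.univ : Finset (Fin N)),
            (∏ y ∈ S, ∑ q, f y q)) := by
          rw [ENNReal.ofReal_sum_of_nonneg]
          exact fun S _ => Finset.prod_nonneg fun y _ => Finset.sum_nonneg fun q _ => hf0 _ _
      _ ≤ _ := by
          refine ENNReal.ofReal_le_ofReal (esymm_bound _ ?_ B hB0 (sum_tree_le hw x) n hn)
          exact fun y => Finset.sum_nonneg fun q _ => hf0 _ _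
  have hKn : (0 : ℝ) < (K : ℝ) ^ n := by positivity
  have : (Real.exp 1 * B / (n * K)) ^ n = (Real.exp 1 * B / n) ^ n / (K : ℝ) ^ n := by
    rw [← div_pow, div_div]
  rw [this, ENNReal.ofReal_div_of_pos hKn, ENNReal.le_div_iff_mul_le, mul_comm]
  · convert hmain using 2
    rw [ENNReal.ofReal_pow hK0.le]
    simp
  · left
    exact (ENNReal.ofReal_pos.2 hKn).ne'
  · left
    simp

lemma lower_tail {N : ℕ} {w : Fin N → ℝ} (hw : ∀ x, 0 < w x) (x : Fin N)
    (h1 : ∀ y, w x * w y ≤ ∑ z, w z) (h2 : w x ≤ (∑ z, w z) / 2) :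
    grgMeasure w {ω | (degA (Adj ω) x : ℝ) < w x / 16} ≤ ENNReal.ofReal (Real.exp (-(w x / 16))) := by
  classical
  have hprob := grg_prob hw
  have hW := sum_w_pos hw x
  set W := ∑ z, w z with hWdef
  let Y : Finset (Fin N) := Finset.univ.erase x
  have hY : ∀ y : Y, x ≠ (y : Fin N) := fun y => (Finset.ne_of_mem_erase y.2).symm
  let e : Y → EdgeIdx N := fun y => mkE x y (hY y)
  have he : Function.Injective e := by
    intro y y' h
    rcases mkE_inj h with h' | h'
    · exact Subtype.ext h'.2
    · exact absurd h'.1 (hY y')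
  let F := Finset.univ.image e
  have hsum : ∀ φ : EdgeIdx N → ℝ, ∑ j ∈ F, φ j = ∑ y : Y, φ (e y) := fun φ =>
    Finset.sum_image (fun a _ b _ h => he h)
  have hdeg : ∀ ω : EdgeIdx N → Bool, (degA (Adj ω) x : ℝ) =
      ∑ j ∈ F, (if ω j = true then (1 : ℝ) else 0) := by
    intro ω
    rw [hsum]
    have : ∀ y : Y, (if ω (e y) = true then (1 : ℝ) else 0) = if Adj ω x y then 1 else 0 := by
      intro y
      simp only [e, ← adj_iff ω (hY y)]
    simp_rw [this]
    rw [Finset.sum_coe_sort Y (fun y => if Adj ω x y then (1 : ℝ) else 0), Finset.sum_boole,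
      degA, Set.ncard_eq_toFinset_card']
    congr 2
    ext y
    simp only [Set.mem_toFinset, Set.mem_ofPred_eq, Finset.mem_filter, Y, Finset.mem_erase,
      Finset.mem_univ, and_true]
    exact ⟨fun h => ⟨(adj_ne h).symm, h⟩, fun h => h.2⟩
  have hp : w x / 4 ≤ ∑ j ∈ F, pGRG w j.1.1 j.1.2 := by
    rw [hsum]
    simp only [e, pGRG_mkE]
    rw [Finset.sum_coe_sort Y (fun y => pGRG w x y)]
    have hwx := hw x
    calc w x / 4 ≤ w x * (W - w x) / (2 * W) := by
          rw [div_le_div_iff₀ (by norm_num) (by positivity)]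
          nlinarith
      _ = ∑ y ∈ Y, w x * w y / (2 * W) := by
          rw [← Finset.sum_div, ← Finset.mul_sum]
          have : ∑ y ∈ Y, w y = W - w x := by
            rw [hWdef, ← Finset.sum_erase_add _ _ (Finset.mem_univ x)]
            simp [Y]
          rw [this]
      _ ≤ ∑ y ∈ Y, pGRG w x y := by
          refine Finset.sum_le_sum fun y _ => ?_
          have := hw y
          have := h1 y
          unfold pGRG
          gcongr
          linarith
  let f : EdgeIdx N → Bool → ℝ := fun j b => if j ∈ F then (if b then Real.exp (-1) else 1) else 1
  have hfprod : ∀ ω : EdgeIdx N → Bool, ∏ j, f j (ω j) = Real.exp (-(degA (Adj ω) x : ℝ)) := by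
    intro ω
    simp only [f]
    rw [Finset.prod_ite_mem, Finset.univ_inter, hdeg, ← Finset.sum_neg_distrib, Real.exp_sum]
    refine Finset.prod_congr rfl fun j _ => ?_
    split_ifs <;> simp
  have hint : ∫ ω, Real.exp (-(degA (Adj ω) x : ℝ)) ∂(grgMeasure w) ≤ Real.exp (-(w x / 8)) := by
    simp_rw [← hfprod]
    rw [grgMeasure, integral_fintype_prod_eq_prod]
    calc ∏ j : EdgeIdx N, ∫ b, f j b ∂(bern (pGRG w j.1.1 j.1.2))
        ≤ ∏ j : EdgeIdx N, (if j ∈ F then Real.exp (-(pGRG w j.1.1 j.1.2 / 2)) else 1) := by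
          refine Finset.prod_le_prod (fun j _ => ?_) fun j _ => ?_
          · refine integral_nonneg fun b => ?_
            simp only [f]
            split_ifs <;> simp [Real.exp_nonneg]
          · have hp0 := pGRG_nonneg hw j.1.1 j.1.2
            have hp1 := pGRG_le_one hw j.1.1 j.1.2
            set p := pGRG w j.1.1 j.1.2
            have hpr := bern_prob hp0 hp1
            split_ifs with hj
            · simp only [f, hj, if_true]
              rw [bern, integral_add_measure
                  ((Integrable.of_finite (μ := Measure.dirac true)).smul_measure
                    ENNReal.ofReal_ne_top)
                  ((Integrable.of_finite (μ := Measure.dirac false)).smul_measure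
                    ENNReal.ofReal_ne_top),
                integral_smul_measure, integral_smul_measure, integral_dirac, integral_dirac]
              rw [ENNReal.toReal_ofReal hp0, ENNReal.toReal_ofReal (by linarith)]
              simp only [smul_eq_mul, if_true, Bool.false_eq_true, if_false]
              have h3 : Real.exp (-1) ≤ 1 / 2 := by
                rw [Real.exp_neg, one_div]
                have := Real.add_one_le_exp (1 : ℝ)
                gcongr
                linarith
              have h4 := Real.add_one_le_exp (-(p / 2))
              nlinarith
            · simp [f, hj]
      _ = Real.exp (-((∑ j ∈ F, pGRG w j.1.1 j.1.2) / 2)) := by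
          rw [Finset.prod_ite_mem, Finset.univ_inter, ← Real.exp_sum, Finset.sum_neg_distrib,
            Finset.sum_div]
      _ ≤ Real.exp (-(w x / 8)) := by
          refine Real.exp_le_exp.2 ?_
          linarith
  have hmk := mul_meas_ge_le_integral_of_nonneg (μ := grgMeasure w)
    (f := fun ω => Real.exp (-(degA (Adj ω) x : ℝ)))
    (Filter.Eventually.of_forall fun ω => Real.exp_nonneg _) (Integrable.of_finite)
    (Real.exp (-(w x / 16)))
  have hle : (grgMeasure w).real {ω | Real.exp (-(w x / 16)) ≤ Real.exp (-(degA (Adj ω) x : ℝ))} ≤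
      Real.exp (-(w x / 16)) := by
    have h5 := hmk.trans hint
    have h6 : Real.exp (-(w x / 8)) = Real.exp (-(w x / 16)) * Real.exp (-(w x / 16)) := by
      rw [← Real.exp_add]
      congr 1
      ring
    rw [h6] at h5
    exact le_of_mul_le_mul_left h5 (Real.exp_pos _)
  rw [← ENNReal.ofReal_toReal (measure_ne_top (grgMeasure w) _)]
  refine ENNReal.ofReal_le_ofReal (le_trans ?_ hle)
  refine measureReal_mono ?_
  intro ω hω
  have hω' : (degA (Adj ω) x : ℝ) < w x / 16 := hω
  show Real.exp (-(w x / 16)) ≤ Real.exp (-(degA (Adj ω) x : ℝ))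
  exact Real.exp_le_exp.2 (by linarith)

end GRG

namespace GRG

lemma eventual_facts (ν κ C2 a : ℝ) (hν : 0 < ν) (hκ : 0 < κ) (hC2 : 0 < C2) (ha : 0 < a) :
    ∀ᶠ l : ℝ in Filter.atTop, Real.exp 1 ≤ l ∧ 64 ≤ 16 * ν * l ∧ 2 * Real.log l ≤ κ * l ∧
      C2 * Real.log l ^ 2 ≤ l ^ a := by
  have h1 := Real.isLittleO_log_id_atTop.bound (show (0 : ℝ) < κ / 2 by positivity)
  have h2 := (isLittleO_log_rpow_rpow_atTop (2 : ℝ) ha).bound (show (0 : ℝ) < 1 / C2 by positivity)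
  filter_upwards [h1, h2, Filter.eventually_ge_atTop (Real.exp 1),
    Filter.eventually_ge_atTop (4 / ν)] with l h1 h2 h3 h4
  have hl : 0 < l := lt_of_lt_of_le (Real.exp_pos 1) h3
  refine ⟨h3, ?_, ?_, ?_⟩
  · rw [div_le_iff₀ hν] at h4
    linarith
  · rw [Real.norm_eq_abs, Real.norm_eq_abs, id, abs_of_pos hl] at h1
    have := le_abs_self (Real.log l)
    linarith
  · rw [Real.rpow_two, Real.norm_eq_abs, Real.norm_eq_abs, abs_of_nonneg (sq_nonneg _),
      abs_of_nonneg (by positivity), one_div, inv_mul_eq_div, le_div_iff₀ hC2] at h2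
    linarith

lemma pow_bound {l s c ν β : ℝ} (hl : 1 < l) (hs : 0 < s) (hc : 0 < c) (hν : 0 < ν)
    (hβ : 0 ≤ β) (hβl : β ≤ l ^ (-(s / c))) {n : ℕ}
    (hn : c * (ν / s) * (l / Real.log l) ≤ n) : β ^ n ≤ Real.exp (-(ν * l)) := by
  have hl0 : 0 < l := by linarith
  have hlog : 0 < Real.log l := Real.log_pos hl
  calc β ^ n ≤ (l ^ (-(s / c))) ^ n := by gcongr
    _ = Real.exp (-(n * (Real.log l * (s / c)))) := by
        rw [Real.rpow_def_of_pos hl0, ← Real.exp_nat_mul]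
        congr 1
        ring
    _ ≤ Real.exp (-(ν * l)) := by
        refine Real.exp_le_exp.2 (neg_le_neg ?_)
        calc ν * l = c * (ν / s) * (l / Real.log l) * (Real.log l * (s / c)) := by field_simp
          _ ≤ n * (Real.log l * (s / c)) := by gcongr

end GRG

set_option maxHeartbeats 2000000

open GRG in
/-- Few down-up edges at each vertex.
Under (A1) and (A2), for every `ν > 0`, every constant `c > 1` and every vertex `x`,
with `ν`-high probability `#S_1^du(x) ≤ c (ν/(1−2δ)) log N / log log N`. -/
theorem card_S1du_bounded
    (ε δ : ℝ) (hε : 0 < ε) (hε' : ε < 1 / 2) (hδ : 0 < δ) (hδ' : δ < 1 / 3)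
    (r : ℕ) (hr : 6 ≤ r)
    (w : (N : ℕ) → Fin N → ℝ)
    (hpos : ∀ N x, 0 < w N x)
    (hA1 : ∀ N x, w N x ≤ (N : ℝ) ^ ((1 : ℝ) / 2 - ε))
    (hA2m1 : ∀ N : ℕ, 1 ≤ N → (N : ℝ) ^ (-ε) ≤ m1 (w N))
    (hA2m2 : ∃ C > 0, ∀ N : ℕ, 2 ≤ N → m2 (w N) / m1 (w N) ≤ C * Real.log N ^ δ)
    (ν : ℝ) (hν : 0 < ν) (c : ℝ) (hc : 1 < c) :
    ∃ C > (0 : ℝ), ∀ (N : ℕ) (x : Fin N),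
      1 - ENNReal.ofReal (C * (N : ℝ) ^ (-ν)) ≤
        grgMeasure (w N) {ω | ((S1duA (Adj ω) r x).ncard : ℝ) ≤
          c * (ν / (1 - 2 * δ)) * (Real.log N / Real.log (Real.log N))} := by
  obtain ⟨Cm, hCm, hQ⟩ := hA2m2
  set s : ℝ := 1 - 2 * δ with hs
  have hs0 : 0 < s := by rw [hs]; linarith
  have hc0 : 0 < c := by linarith
  set κ : ℝ := c * (ν / s) with hκ
  have hκ0 : 0 < κ := by positivity
  set C1 : ℝ := 32 + 32 * ν / κ with hC1
  have hC10 : 0 < C1 := by positivity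
  set C2 : ℝ := Real.exp 1 * C1 * Cm ^ 2 / κ with hC2
  have hC20 : 0 < C2 := by positivity
  obtain ⟨N0, hN0⟩ := Filter.eventually_atTop.1
    (((Real.tendsto_log_atTop.comp tendsto_natCast_atTop_atTop).eventually
      (eventual_facts ν κ C2 (s * (1 - 1 / c)) hν hκ0 hC20 (by
        have : 1 / c < 1 := by rw [div_lt_one hc0]; exact hc
        have : 0 < 1 - 1 / c := by linarith
        positivity))).and (Filter.eventually_ge_atTop 4))
  refine ⟨max 2 ((N0 : ℝ) ^ ν), lt_max_of_lt_left two_pos, fun N x => ?_⟩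
  have hw := hpos N
  have hNpos : 0 < N := x.pos
  have hNR : (0 : ℝ) < N := by exact_mod_cast hNpos
  have hprob := grg_prob hw
  rcases lt_or_ge N N0 with hlt | hge
  · have : (1 : ℝ) ≤ max 2 ((N0 : ℝ) ^ ν) * (N : ℝ) ^ (-ν) := by
      have h1 : (N : ℝ) ^ ν ≤ max 2 ((N0 : ℝ) ^ ν) := by
        refine le_max_of_le_right ?_
        gcongr
      have h2 : (N : ℝ) ^ ν * (N : ℝ) ^ (-ν) = 1 := by
        rw [← Real.rpow_add hNR]; simp
      rw [← h2]
      gcongr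
    rw [tsub_eq_zero_of_le]
    · exact zero_le
    · rw [← ENNReal.ofReal_one]
      exact ENNReal.ofReal_le_ofReal this
  obtain ⟨⟨hl1, hl2, hl3, hl4⟩, hN4⟩ := hN0 N hge
  simp only [Function.comp_apply] at hl1 hl2 hl3 hl4
  set ℓ : ℝ := Real.log N with hℓ
  have hlog1 : 1 ≤ Real.log ℓ := by
    rw [Real.le_log_iff_exp_le (lt_of_lt_of_le (Real.exp_pos 1) hl1)]
    exact hl1
  have hℓ1 : 1 < ℓ := lt_of_lt_of_le (by have := Real.add_one_le_exp (1 : ℝ); linarith) hl1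
  have hℓ0 : 0 < ℓ := by linarith
  have hexpN : Real.exp (-(ν * ℓ)) = (N : ℝ) ^ (-ν) := by
    rw [Real.rpow_def_of_pos hNR]
    congr 1
    ring
  -- thresholds
  set T : ℝ := κ * (ℓ / Real.log ℓ) with hT
  have hT0 : 0 < T := by positivity
  have hT2 : 2 ≤ T := by
    rw [hT, ← mul_div_assoc, le_div_iff₀ (by linarith)]
    linarith
  set n : ℕ := ⌊T⌋₊ + 1 with hn
  have hnT : T ≤ n := by
    rw [hn]; push_cast; exact (Nat.lt_floor_add_one T).le
  have hwx := hw x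
  have hW := sum_w_pos hw x
  set Q : ℝ := (∑ z, w N z ^ 2) / ∑ z, w N z with hQdef
  have hQle : Q ≤ Cm * ℓ ^ δ := by
    have := hQ N (by omega)
    rw [m2, m1, div_div_div_cancel_right₀ hNR.ne'] at this
    exact this
  have hQ0 : 0 ≤ Q := div_nonneg (Finset.sum_nonneg fun i _ => sq_nonneg _) hW.le
  have hlpow : (ℓ ^ δ) ^ 2 = ℓ ^ (2 * δ) := by
    rw [← Real.rpow_natCast, ← Real.rpow_mul hℓ0.le]
    congr 1
    push_cast
    ring
  -- the tree estimate
  have key : ∀ K : ℕ, 1 ≤ K → w N x / K ≤ C1 * Real.log ℓ →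
      grgMeasure (w N) {ω | n ≤ (S1duA (Adj ω) r x).ncard ∧ K + 1 ≤ degA (Adj ω) x} ≤
        ENNReal.ofReal ((N : ℝ) ^ (-ν)) := by
    intro K hK hKw
    refine (tree_bound hw hr x n K (by omega) hK).trans (ENNReal.ofReal_le_ofReal ?_)
    have hK0 : (0 : ℝ) < K := by exact_mod_cast hK
    have hn0 : (0 : ℝ) < n := by linarith
    rw [← hexpN]
    refine pow_bound hℓ1 hs0 hc0 hν (by positivity) ?_ (n := n) hnT
    calc Real.exp 1 * (w N x * Q ^ 2) / (n * K)
        = Real.exp 1 * (w N x / K) * Q ^ 2 / n := by field_simp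
      _ ≤ Real.exp 1 * (C1 * Real.log ℓ) * (Cm * ℓ ^ δ) ^ 2 / T := by
          have : 0 ≤ Real.log ℓ := by linarith
          gcongr
      _ = C2 * Real.log ℓ ^ 2 * (ℓ ^ (2 * δ) * ℓ ^ (-1 : ℝ)) := by
          rw [mul_pow, hlpow, hC2, hT, Real.rpow_neg_one]
          field_simp
      _ ≤ ℓ ^ (s * (1 - 1 / c)) * (ℓ ^ (2 * δ) * ℓ ^ (-1 : ℝ)) := by
          gcongr
      _ = ℓ ^ (-(s / c)) := by
          rw [← Real.rpow_add hℓ0, ← Real.rpow_add hℓ0]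
          congr 1
          rw [hs]
          field_simp
          ring
  -- the bad event
  have hbad : grgMeasure (w N) {ω | n ≤ (S1duA (Adj ω) r x).ncard} ≤
      ENNReal.ofReal (2 * (N : ℝ) ^ (-ν)) := by
    have hNν : (0 : ℝ) ≤ (N : ℝ) ^ (-ν) := by positivity
    rcases lt_or_ge (w N x) (16 * ν * ℓ) with hcase | hcase
    · have hfl : 1 ≤ ⌊T⌋₊ := Nat.le_floor (by push_cast; linarith)
      have h := key ⌊T⌋₊ hfl (by
        have h1 : T / 2 ≤ (⌊T⌋₊ : ℝ) := by
          have := Nat.lt_floor_add_one T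
          linarith
        calc w N x / ⌊T⌋₊ ≤ (16 * ν * ℓ) / (T / 2) := by gcongr
          _ = 32 * ν / κ * Real.log ℓ := by
              rw [hT]
              field_simp
              norm_num
          _ ≤ C1 * Real.log ℓ := by
              rw [hC1]
              nlinarith)
      refine le_trans (measure_mono ?_) (h.trans (ENNReal.ofReal_le_ofReal (by linarith)))
      intro ω hω
      have hω' : n ≤ (S1duA (Adj ω) r x).ncard := hω
      refine ⟨hω', le_trans hω' ?_⟩
      exact Set.ncard_le_ncard (fun y hy => hy.1) (Set.toFinite _)
    · have hw64 : 64 ≤ w N x := by linarith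
      have hm1 := hA2m1 N (by omega)
      have hWge : (N : ℝ) ^ (1 - ε) ≤ ∑ z, w N z := by
        rw [m1, le_div_iff₀ hNR] at hm1
        refine le_trans (le_of_eq ?_) hm1
        conv_rhs => rw [← Real.rpow_one (N : ℝ), ← Real.rpow_mul hNR.le, ← Real.rpow_add hNR]
        congr 1
        ring
      have hN1 : (1 : ℝ) ≤ N := by exact_mod_cast hNpos
      have ht := lower_tail hw x (by
        intro y
        calc w N x * w N y ≤ (N : ℝ) ^ ((1 : ℝ) / 2 - ε) * (N : ℝ) ^ ((1 : ℝ) / 2 - ε) := by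
              have := hA1 N x
              have := hA1 N y
              have := hw y
              gcongr
          _ = (N : ℝ) ^ (1 - 2 * ε) := by
              rw [← Real.rpow_add hNR]
              congr 1
              ring
          _ ≤ (N : ℝ) ^ (1 - ε) := Real.rpow_le_rpow_of_exponent_le hN1 (by linarith)
          _ ≤ _ := hWge) (by
        have h4 : (2 : ℝ) ≤ (N : ℝ) ^ ((1 : ℝ) / 2) := by
          rw [← Real.sqrt_eq_rpow]
          refine Real.le_sqrt_of_sq_le ?_
          have : (4 : ℝ) ≤ N := by exact_mod_cast hN4
          linarith
        have h5 : (N : ℝ) ^ ((1 : ℝ) / 2 - ε) * (N : ℝ) ^ ((1 : ℝ) / 2) = (N : ℝ) ^ (1 - ε) := by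
          rw [← Real.rpow_add hNR]
          congr 1
          ring
        have h6 := hA1 N x
        have h7 : (0 : ℝ) ≤ (N : ℝ) ^ ((1 : ℝ) / 2 - ε) := by positivity
        nlinarith)
      have ht' : grgMeasure (w N) {ω | (degA (Adj ω) x : ℝ) < w N x / 16} ≤
          ENNReal.ofReal ((N : ℝ) ^ (-ν)) := by
        refine ht.trans (ENNReal.ofReal_le_ofReal ?_)
        rw [← hexpN]
        exact Real.exp_le_exp.2 (by linarith)
      set K : ℕ := ⌈w N x / 16⌉₊ - 1 with hK
      have hceil : w N x / 16 ≤ (⌈w N x / 16⌉₊ : ℝ) := Nat.le_ceil _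
      have hceil2 : 2 ≤ ⌈w N x / 16⌉₊ := by
        have : (2 : ℝ) ≤ (⌈w N x / 16⌉₊ : ℝ) := by linarith
        exact_mod_cast this
      have hK1 : 1 ≤ K := by omega
      have hKc : K + 1 = ⌈w N x / 16⌉₊ := by omega
      have hKR : (K : ℝ) + 1 = (⌈w N x / 16⌉₊ : ℝ) := by exact_mod_cast hKc
      have hKlow : w N x / 32 ≤ K := by linarith
      have h := key K hK1 (by
        have hK0 : (0 : ℝ) < K := by exact_mod_cast hK1
        have : 0 ≤ 32 * ν / κ := by positivity
        calc w N x / K ≤ 32 := by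
              rw [div_le_iff₀ hK0]
              linarith
          _ ≤ C1 * 1 := by rw [hC1]; linarith
          _ ≤ C1 * Real.log ℓ := by gcongr)
      calc grgMeasure (w N) {ω | n ≤ (S1duA (Adj ω) r x).ncard}
          ≤ grgMeasure (w N) ({ω | (degA (Adj ω) x : ℝ) < w N x / 16} ∪
            {ω | n ≤ (S1duA (Adj ω) r x).ncard ∧ K + 1 ≤ degA (Adj ω) x}) := by
            refine measure_mono ?_
            intro ω hω
            by_cases hd : (degA (Adj ω) x : ℝ) < w N x / 16
            · exact Or.inl hd
            · refine Or.inr ⟨hω, ?_⟩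
              rw [hKc]
              exact Nat.ceil_le.2 (not_lt.1 hd)
        _ ≤ ENNReal.ofReal ((N : ℝ) ^ (-ν)) + ENNReal.ofReal ((N : ℝ) ^ (-ν)) :=
            (measure_union_le _ _).trans (add_le_add ht' h)
        _ = ENNReal.ofReal (2 * (N : ℝ) ^ (-ν)) := by
            rw [← ENNReal.ofReal_add hNν hNν]
            congr 1
            ring
  have hcompl : {ω : EdgeIdx N → Bool | ((S1duA (Adj ω) r x).ncard : ℝ) ≤ T}ᶜ ⊆
      {ω | n ≤ (S1duA (Adj ω) r x).ncard} := by
    intro ω hω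
    have hω' : T < ((S1duA (Adj ω) r x).ncard : ℝ) := not_le.1 hω
    show n ≤ (S1duA (Adj ω) r x).ncard
    rw [hn, Nat.succ_le_iff]
    exact (Nat.floor_lt hT0.le).2 hω'
  rw [tsub_le_iff_right]
  calc (1 : ENNReal) = grgMeasure (w N) Set.univ := measure_univ.symm
    _ ≤ grgMeasure (w N) {ω : EdgeIdx N → Bool | ((S1duA (Adj ω) r x).ncard : ℝ) ≤ T} +
        grgMeasure (w N) {ω : EdgeIdx N → Bool | ((S1duA (Adj ω) r x).ncard : ℝ) ≤ T}ᶜ := by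
        rw [← Set.union_compl_self
          {ω : EdgeIdx N → Bool | ((S1duA (Adj ω) r x).ncard : ℝ) ≤ T}]
        exact measure_union_le _ _
    _ ≤ _ := by
        gcongr
        refine (measure_mono hcompl).trans (hbad.trans (ENNReal.ofReal_le_ofReal ?_))
        gcongr
        exact le_max_left _ _
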